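/- Fix q ∈ (0,1), an integer y ≥ 1 and a ∈ ℝ. Suppose f : ℤ^y → ℝ satisfies: for every i ∈ {1,…,y−1} and every n⃗ ∈ ℤ^y with n_i = n_{i+1}, ([∇]_i − q [∇]_{i+1}) f(n⃗) = 0. Then for every n ∈ ℤ: ([∇_a]_1 [∇_a]_2 ⋯ [∇_a]_y f)(n,n,…,n) = ∑_{s=0}^{y} C_a(y,s) f(n,…,n, n−1,…,n−1), where on the right the first y−s coordinates equal n and the last s coordinates equal n−1. -/

import Mathlib

/-- The q-Pochhammer symbol `(a;q)_n = ∏_{i=0}^{n-1} (1 - a q^i)`. -/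
noncomputable def qPoch (q a : ℝ) (n : ℕ) : ℝ := ∏ i ∈ Finset.range n, (1 - a * q ^ i)

/-- The coefficients `C_a(y,s)`, with the convention `C_a(y,s) = 0` for `s < 0` or `s > y`. -/
noncomputable def Cco (q a : ℝ) (y : ℕ) (s : ℤ) : ℝ :=
  if 0 ≤ s ∧ s ≤ (y : ℤ) then
    (-a) ^ s.toNat * qPoch q (-a) (y - s.toNat) *
      (qPoch q q y / (qPoch q q (y - s.toNat) * qPoch q q s.toNat))
  else 0

/-- `([∇]_i f)(n⃗) = f(n⃗ - e_i) - f(n⃗)`. -/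
noncomputable def nablaD {k : ℕ} (i : Fin k) (f : (Fin k → ℤ) → ℝ) (n : Fin k → ℤ) : ℝ :=
  f (Function.update n i (n i - 1)) - f n

/-- `([∇_x]_i f)(n⃗) = (1+x) f(n⃗) - x f(n⃗ - e_i)`. -/
noncomputable def nablaX {k : ℕ} (x : ℝ) (i : Fin k) (f : (Fin k → ℤ) → ℝ)
    (n : Fin k → ℤ) : ℝ :=
  (1 + x) * f n - x * f (Function.update n i (n i - 1))

/-- The vector whose first `t` coordinates are `n` and whose other coordinates are `n - 1`. -/
def stepVector (y : ℕ) (n : ℤ) (t : ℕ) : Fin y → ℤ := fun i => if (i : ℕ) < t then n else n - 1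

/-- The relation `([∇]_i - q [∇]_{i+1}) f = 0` on `n_i = n_{i+1}`, for all adjacent pairs. -/
def AdjacentRelation (q : ℝ) (y : ℕ) (f : (Fin y → ℤ) → ℝ) : Prop :=
  ∀ (i j : Fin y), (j : ℕ) = i + 1 → ∀ n : Fin y → ℤ, n i = n j →
    nablaD i f n - q * nablaD j f n = 0

lemma AdjacentRelation.cons {q : ℝ} {y : ℕ} {f : (Fin (y + 1) → ℤ) → ℝ}
    (hf : AdjacentRelation q (y + 1) f) (v : ℤ) :
    AdjacentRelation q y (fun w => f (Fin.cons v w)) := by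
  intro i j hij n hn
  have h := hf i.succ j.succ (by simp [hij]) (Fin.cons v n) (by simpa only [Fin.cons_succ] using hn)
  simpa only [nablaD, Fin.cons_succ, ← Fin.cons_update] using h

lemma AdjacentRelation.update_stepVector {q : ℝ} {y : ℕ} {f : (Fin y → ℤ) → ℝ}
    (hf : AdjacentRelation q y f) (n : ℤ) {t : ℕ} (ht : t < y) (k : ℕ) :
    ∀ i : Fin y, (i : ℕ) + k = t →
      f (Function.update (stepVector y n (t + 1)) i (n - 1))
        = q ^ k * f (stepVector y n t) + (1 - q ^ k) * f (stepVector y n (t + 1)) := by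
  induction k with
  | zero =>
    intro i hi
    have e : Function.update (stepVector y n (t + 1)) i (n - 1) = stepVector y n t := by
      funext j
      by_cases hij : j = i
      · subst hij
        simp [stepVector, ← hi]
      · have hne : (j : ℕ) ≠ i := fun h' => hij (Fin.ext h')
        have hiff : ((j : ℕ) < t + 1) ↔ ((j : ℕ) < t) := by omega
        rw [Function.update_of_ne hij]
        simp only [stepVector, hiff]
    rw [e]
    ring
  | succ k ih =>
    intro i hi
    have hi' : (i : ℕ) + 1 < y := by omega
    have v₁ : stepVector y n (t + 1) i = n := if_pos (by omega)
    have v₂ : stepVector y n (t + 1) ⟨i + 1, hi'⟩ = n := if_pos (by change (i : ℕ) + 1 < _; omega)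
    have hr := hf i ⟨i + 1, hi'⟩ rfl (stepVector y n (t + 1)) (v₁.trans v₂.symm)
    simp only [nablaD] at hr
    rw [v₁, v₂, ih ⟨i + 1, hi'⟩ (by change (i : ℕ) + 1 + k = t; omega)] at hr
    rw [pow_succ]
    linear_combination hr

lemma foldr_nablaX_map_succ (a : ℝ) {y : ℕ} (f : (Fin (y + 1) → ℤ) → ℝ) (v : ℤ)
    (l : List (Fin y)) (w : Fin y → ℤ) :
    ((l.map Fin.succ).foldr (fun i g => nablaX a i g) f) (Fin.cons v w)
      = (l.foldr (fun i g => nablaX a i g) (fun w => f (Fin.cons v w))) w := by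
  induction l generalizing w with
  | nil => rfl
  | cons i l ih =>
    simp only [List.map_cons, List.foldr_cons, nablaX, Fin.cons_succ, ← Fin.cons_update, ih]

lemma qPoch_succ (q a : ℝ) (n : ℕ) : qPoch q a (n + 1) = qPoch q a n * (1 - a * q ^ n) :=
  Finset.prod_range_succ _ _

lemma qPoch_self_ne_zero {q : ℝ} (hq : q ∈ Set.Ioo (0 : ℝ) 1) (n : ℕ) : qPoch q q n ≠ 0 := by
  refine Finset.prod_ne_zero_iff.2 fun i _ => ?_
  have h : q ^ (i + 1) < 1 := pow_lt_one₀ hq.1.le hq.2 (Nat.succ_ne_zero i)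
  rw [pow_succ'] at h
  exact (sub_pos.2 h).ne'

lemma Cco_of_le {q a : ℝ} {y s : ℕ} (h : s ≤ y) :
    Cco q a y (s : ℤ) = (-a) ^ s * qPoch q (-a) (y - s) *
      (qPoch q q y / (qPoch q q (y - s) * qPoch q q s)) := by
  rw [Cco, if_pos ⟨by positivity, by exact_mod_cast h⟩]
  simp

lemma Cco_self_add_one (q a : ℝ) (y : ℕ) : Cco q a y ((y + 1 : ℕ) : ℤ) = 0 :=
  if_neg (by push_cast; omega)

lemma Cco_succ_zero {q : ℝ} (hq : q ∈ Set.Ioo (0 : ℝ) 1) (a : ℝ) (y : ℕ) :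
    Cco q a (y + 1) ((0 : ℕ) : ℤ) = (1 + a * q ^ y) * Cco q a y ((0 : ℕ) : ℤ) := by
  have h₁ := qPoch_self_ne_zero hq y
  have h₂ := qPoch_self_ne_zero hq (y + 1)
  have h₀ : qPoch q q 0 = 1 := by simp [qPoch]
  rw [Cco_of_le (Nat.zero_le _), Cco_of_le (Nat.zero_le _)]
  simp only [Nat.sub_zero, h₀, mul_one, div_self h₁, div_self h₂, qPoch_succ q (-a)]
  ring

/-- The `q`-Pascal recursion for the coefficients `C_a(y,s)`. -/
lemma Cco_succ_succ {q : ℝ} (hq : q ∈ Set.Ioo (0 : ℝ) 1) (a : ℝ) {y s : ℕ} (h : s ≤ y) :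
    Cco q a (y + 1) ((s + 1 : ℕ) : ℤ)
      = (1 + a * q ^ (y - (s + 1))) * Cco q a y ((s + 1 : ℕ) : ℤ)
        - a * q ^ (y - s) * Cco q a y (s : ℤ) := by
  obtain ⟨m, rfl⟩ := Nat.exists_eq_add_of_le h
  have hs := qPoch_self_ne_zero hq s
  have hs' := qPoch_self_ne_zero hq (s + 1)
  have hm := qPoch_self_ne_zero hq m
  rw [qPoch_succ] at hs'
  have hs'' := right_ne_zero_of_mul hs'
  rw [Cco_of_le (by omega : s + 1 ≤ s + m + 1), Cco_of_le h]
  rcases m with _ | m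
  · rw [add_zero, Cco_self_add_one]
    have h₁ := qPoch_self_ne_zero hq (s + 1)
    have h₀ : qPoch q q 0 = 1 := by simp [qPoch]
    simp only [Nat.sub_self, h₀, one_mul, div_self hs, div_self h₁]
    ring
  · have hm' := qPoch_self_ne_zero hq m
    rw [qPoch_succ] at hm
    have hm'' := right_ne_zero_of_mul hm
    rw [Cco_of_le (by omega : s + 1 ≤ s + (m + 1))]
    have e₁ : s + (m + 1) + 1 - (s + 1) = m + 1 := by omega
    have e₂ : s + (m + 1) - s = m + 1 := by omega
    have e₃ : s + (m + 1) - (s + 1) = m := by omega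
    rw [e₁, e₂, e₃]
    simp only [qPoch_succ, pow_add, pow_one] at hm'' hs'' ⊢
    generalize q ^ m = x at *
    generalize q ^ s = z at *
    generalize hA : 1 - q * x = A at *
    generalize hB : 1 - q * z = B at *
    field_simp
    rw [← hA, ← hB]
    ring

/-- The expansion of `[∇_a]_1 ⋯ [∇_a]_y f` on the diagonal. -/
lemma AdjacentRelation.foldr_nablaX_diagonal {q : ℝ} (hq : q ∈ Set.Ioo (0 : ℝ) 1) (a : ℝ)
    (n : ℤ) {y : ℕ} {f : (Fin y → ℤ) → ℝ} (hf : AdjacentRelation q y f) :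
    ((List.finRange y).foldr (fun i g => nablaX a i g) f) (fun _ => n)
      = ∑ s ∈ Finset.range (y + 1), Cco q a y (s : ℤ) * f (stepVector y n (y - s)) := by
  induction y with
  | zero =>
    have h : stepVector 0 n 0 = fun _ => n := Subsingleton.elim _ _
    simp [h, Cco, qPoch]
  | succ y ih =>
    have hdiag : (fun _ => n : Fin (y + 1) → ℤ) = Fin.cons n (fun _ => n) :=
      (Fin.cons_self_tail (fun _ => n : Fin (y + 1) → ℤ)).symm
    have hstep (t : ℕ) : (Fin.cons n (stepVector y n t) : Fin (y + 1) → ℤ)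
        = stepVector (y + 1) n (t + 1) := by
      funext i
      refine Fin.cases ?_ (fun i => ?_) i <;> simp [stepVector]
    have hmove (s : ℕ) (hs : s ≤ y) :
        f (Fin.cons (n - 1) (stepVector y n (y - s)))
          = q ^ (y - s) * f (stepVector (y + 1) n (y - s))
            + (1 - q ^ (y - s)) * f (stepVector (y + 1) n (y - s + 1)) := by
      have h := hf.update_stepVector n (by omega : y - s < y + 1) (y - s) 0 (zero_add _)
      rw [← hstep] at h
      rw [← hstep, ← h]
      rw [Fin.update_cons_zero]
    rw [List.finRange_succ, List.foldr_cons, nablaX, hdiag, Fin.update_cons_zero,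
      foldr_nablaX_map_succ, foldr_nablaX_map_succ, ih (hf.cons n), ih (hf.cons (n - 1)),
      Finset.mul_sum, Finset.mul_sum, ← Finset.sum_sub_distrib]
    have hterm : ∀ s ∈ Finset.range (y + 1),
        (1 + a) * (Cco q a y (s : ℤ) * f (Fin.cons n (stepVector y n (y - s))))
          - a * (Cco q a y (s : ℤ) * f (Fin.cons (n - 1) (stepVector y n (y - s))))
        = (1 + a * q ^ (y - s)) * Cco q a y (s : ℤ) * f (stepVector (y + 1) n (y + 1 - s))
          - a * q ^ (y - s) * Cco q a y (s : ℤ)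
            * f (stepVector (y + 1) n (y + 1 - (s + 1))) := by
      intro s hs
      have hs' : s ≤ y := Nat.lt_succ_iff.1 (Finset.mem_range.1 hs)
      rw [hmove s hs', hstep, Nat.add_sub_add_right, Nat.sub_add_comm hs']
      ring
    have hpascal : ∀ s ∈ Finset.range (y + 1),
        Cco q a (y + 1) ((s + 1 : ℕ) : ℤ) * f (stepVector (y + 1) n (y + 1 - (s + 1)))
        = (1 + a * q ^ (y - (s + 1))) * Cco q a y ((s + 1 : ℕ) : ℤ)
            * f (stepVector (y + 1) n (y + 1 - (s + 1)))
          - a * q ^ (y - s) * Cco q a y (s : ℤ)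
            * f (stepVector (y + 1) n (y + 1 - (s + 1))) := by
      intro s hs
      rw [Cco_succ_succ hq a (Nat.lt_succ_iff.1 (Finset.mem_range.1 hs))]
      ring
    rw [Finset.sum_congr rfl hterm, Finset.sum_sub_distrib, Finset.sum_range_succ' _ (y + 1),
      Finset.sum_congr rfl hpascal, Finset.sum_sub_distrib, Cco_succ_zero hq,
      Finset.sum_range_succ' _ y,
      Finset.sum_range_succ (fun s => (1 + a * q ^ (y - (s + 1))) * Cco q a y ((s + 1 : ℕ) : ℤ)
        * f (stepVector (y + 1) n (y + 1 - (s + 1)))) y, Cco_self_add_one]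
    simp only [Nat.sub_zero]
    ring

theorem stmt_7 (q a : ℝ) (hq : q ∈ Set.Ioo (0:ℝ) 1) (y : ℕ) (hy : 1 ≤ y)
    (f : (Fin y → ℤ) → ℝ)
    (hf : ∀ (i : ℕ) (hi : i + 1 < y) (n : Fin y → ℤ),
      n ⟨i, by omega⟩ = n ⟨i + 1, hi⟩ →
      nablaD ⟨i, by omega⟩ f n - q * nablaD ⟨i + 1, hi⟩ f n = 0)
    (n : ℤ) :
    ((List.finRange y).foldr (fun i g => nablaX a i g) f) (fun _ => n)
      = ∑ s ∈ Finset.range (y + 1),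
          Cco q a y (s : ℤ) * f (fun i => if (i : ℕ) < y - s then n else n - 1) := by
  have hadj : AdjacentRelation q y f := by
    rintro ⟨i, hi⟩ ⟨j, hj⟩ hij m hm
    obtain rfl : j = i + 1 := hij
    exact hf i hj m hm
  exact hadj.foldr_nablaX_diagonal hq a n
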